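/- Let X be a complex Banach space, let A, B be bounded linear operators on X, let J, Γ : L(X) → L(X) be bounded linear transforms on the space L(X) of bounded operators such that AΓ(Y) − Γ(Y)A = Y − J(Y) for every Y ∈ L(X), let γ ≥ ‖Γ‖ and j = max{1, ‖J‖}, and suppose (3 + 2√2)·j·γ·‖B‖ < 1. Then the map Φ(Y) = BΓ(Y) − Γ(Y)J(Y) + B has a unique fixed point X* in the closed ball {Y ∈ L(X) : ‖Y − B‖ ≤ √2‖B‖}, the operator I + Γ(X*) is invertible in L(X), and (A − B)(I + Γ(X*)) = (I + Γ(X*))(A − J(X*)); that is, A − B is similar to A − J(X*). (Theorem 3.1 of the paper in the case of a bounded unperturbed operator A with M = L(X).) -/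

import Mathlib

/-- The map `Y ↦ bΓ(Y) − Γ(Y)J(Y) + b` whose fixed points give similarity transforms. -/
noncomputable def similarityMap {R : Type*} [NormedRing R] [NormedAlgebra ℂ R]
    (b : R) (J Γ : R →L[ℂ] R) (Y : R) : R :=
  b * Γ Y - Γ Y * J Y + b

theorem norm_le_of_norm_sub_le_sqrt_two_mul {E : Type*} [SeminormedAddCommGroup E] {b Y : E}
    (hY : ‖Y - b‖ ≤ √2 * ‖b‖) :
    ‖Y‖ ≤ (1 + √2) * ‖b‖ := by
  linarith [norm_le_norm_add_norm_sub' Y b]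

section SimilarityMap

variable {R : Type*} [NormedRing R] [NormedAlgebra ℂ R] {b : R} {J Γ : R →L[ℂ] R} {γ j : ℝ}

theorem norm_similarityMap_sub_le (hΓ : ‖Γ‖ ≤ γ) (hJ : ‖J‖ ≤ j) (hj : 1 ≤ j)
    (hb : (3 + 2 * √2) * j * γ * ‖b‖ ≤ 1) {Y : R} (hY : ‖Y - b‖ ≤ √2 * ‖b‖) :
    ‖similarityMap b J Γ Y - b‖ ≤ √2 * ‖b‖ := by
  have hγ : 0 ≤ γ := (norm_nonneg Γ).trans hΓ
  have hY' := norm_le_of_norm_sub_le_sqrt_two_mul hY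
  have hs : √2 * √2 = 2 := Real.mul_self_sqrt zero_le_two
  have hΓY : ‖Γ Y‖ ≤ γ * ((1 + √2) * ‖b‖) := Γ.le_of_opNorm_le_of_le hΓ hY'
  have hJY : ‖J Y‖ ≤ j * ((1 + √2) * ‖b‖) := J.le_of_opNorm_le_of_le hJ hY'
  calc ‖similarityMap b J Γ Y - b‖ = ‖b * Γ Y - Γ Y * J Y‖ := by simp [similarityMap]
    _ ≤ ‖b‖ * ‖Γ Y‖ + ‖Γ Y‖ * ‖J Y‖ :=
      (norm_sub_le _ _).trans (add_le_add (norm_mul_le _ _) (norm_mul_le _ _))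
    _ ≤ ‖b‖ * (γ * ((1 + √2) * ‖b‖)) + γ * ((1 + √2) * ‖b‖) * (j * ((1 + √2) * ‖b‖)) := by
      gcongr
    _ ≤ j * (‖b‖ * (γ * ((1 + √2) * ‖b‖))) +
        γ * ((1 + √2) * ‖b‖) * (j * ((1 + √2) * ‖b‖)) := by
      gcongr ?_ + _
      exact le_mul_of_one_le_left (by positivity) hj
    _ = √2 * ‖b‖ * ((3 + 2 * √2) * j * γ * ‖b‖) := by
      linear_combination (-j * γ * ‖b‖ ^ 2) * hs
    _ ≤ √2 * ‖b‖ := mul_le_of_le_one_right (by positivity) hb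

theorem norm_similarityMap_sub_similarityMap_le (hΓ : ‖Γ‖ ≤ γ) (hJ : ‖J‖ ≤ j) (hj : 1 ≤ j)
    {Y Z : R} (hY : ‖Y - b‖ ≤ √2 * ‖b‖) (hZ : ‖Z - b‖ ≤ √2 * ‖b‖) :
    ‖similarityMap b J Γ Y - similarityMap b J Γ Z‖ ≤
      (3 + 2 * √2) * j * γ * ‖b‖ * ‖Y - Z‖ := by
  have hγ : 0 ≤ γ := (norm_nonneg Γ).trans hΓ
  have hΓZ : ‖Γ Z‖ ≤ γ * ((1 + √2) * ‖b‖) :=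
    Γ.le_of_opNorm_le_of_le hΓ (norm_le_of_norm_sub_le_sqrt_two_mul hZ)
  have hJY : ‖J Y‖ ≤ j * ((1 + √2) * ‖b‖) :=
    J.le_of_opNorm_le_of_le hJ (norm_le_of_norm_sub_le_sqrt_two_mul hY)
  have hΓd : ‖Γ (Y - Z)‖ ≤ γ * ‖Y - Z‖ := Γ.le_of_opNorm_le hΓ _
  have hJd : ‖J (Y - Z)‖ ≤ j * ‖Y - Z‖ := J.le_of_opNorm_le hJ _
  calc ‖similarityMap b J Γ Y - similarityMap b J Γ Z‖
      = ‖b * Γ (Y - Z) - Γ (Y - Z) * J Y - Γ Z * J (Y - Z)‖ := by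
        congr 1
        simp only [similarityMap, map_sub]
        noncomm_ring
    _ ≤ ‖b‖ * ‖Γ (Y - Z)‖ + ‖Γ (Y - Z)‖ * ‖J Y‖ + ‖Γ Z‖ * ‖J (Y - Z)‖ :=
      (norm_sub_le _ _).trans (add_le_add ((norm_sub_le _ _).trans
        (add_le_add (norm_mul_le _ _) (norm_mul_le _ _))) (norm_mul_le _ _))
    _ ≤ ‖b‖ * (γ * ‖Y - Z‖) + γ * ‖Y - Z‖ * (j * ((1 + √2) * ‖b‖)) +
        γ * ((1 + √2) * ‖b‖) * (j * ‖Y - Z‖) := by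
      gcongr
    _ ≤ j * (‖b‖ * (γ * ‖Y - Z‖)) + γ * ‖Y - Z‖ * (j * ((1 + √2) * ‖b‖)) +
        γ * ((1 + √2) * ‖b‖) * (j * ‖Y - Z‖) := by
      gcongr ?_ + _ + _
      exact le_mul_of_one_le_left (by positivity) hj
    _ = (3 + 2 * √2) * j * γ * ‖b‖ * ‖Y - Z‖ := by ring

theorem exists_similarityMap_eq [CompleteSpace R] (hΓ : ‖Γ‖ ≤ γ) (hJ : ‖J‖ ≤ j) (hj : 1 ≤ j)
    (hb : (3 + 2 * √2) * j * γ * ‖b‖ < 1) :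
    ∃ Y : R, ‖Y - b‖ ≤ √2 * ‖b‖ ∧ similarityMap b J Γ Y = Y := by
  have hγ : 0 ≤ γ := (norm_nonneg Γ).trans hΓ
  have hmaps : Set.MapsTo (similarityMap b J Γ) (Metric.closedBall b (√2 * ‖b‖))
      (Metric.closedBall b (√2 * ‖b‖)) := fun Y hY => by
    rw [mem_closedBall_iff_norm] at hY ⊢
    exact norm_similarityMap_sub_le hΓ hJ hj hb.le hY
  have hcontr : ContractingWith (Real.toNNReal ((3 + 2 * √2) * j * γ * ‖b‖))
      (hmaps.restrict _ _ _) := by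
    refine ⟨Real.toNNReal_lt_one.2 hb, LipschitzWith.of_dist_le_mul fun Y Z => ?_⟩
    rw [Real.coe_toNNReal _ (by positivity), Subtype.dist_eq, Subtype.dist_eq, dist_eq_norm,
      dist_eq_norm]
    exact norm_similarityMap_sub_similarityMap_le hΓ hJ hj
      (mem_closedBall_iff_norm.1 Y.2) (mem_closedBall_iff_norm.1 Z.2)
  obtain ⟨Y, hY, hfix, -⟩ := hcontr.exists_fixedPoint' Metric.isClosed_closedBall.isComplete
    hmaps (Metric.mem_closedBall_self (by positivity)) (edist_ne_top _ _)
  exact ⟨Y, mem_closedBall_iff_norm.1 hY, hfix⟩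

theorem eq_of_similarityMap_eq (hΓ : ‖Γ‖ ≤ γ) (hJ : ‖J‖ ≤ j) (hj : 1 ≤ j)
    (hb : (3 + 2 * √2) * j * γ * ‖b‖ < 1) {Y Z : R}
    (hY : ‖Y - b‖ ≤ √2 * ‖b‖) (hZ : ‖Z - b‖ ≤ √2 * ‖b‖)
    (hYfix : similarityMap b J Γ Y = Y) (hZfix : similarityMap b J Γ Z = Z) : Y = Z := by
  have h := norm_similarityMap_sub_similarityMap_le hΓ hJ hj hY hZ
  rw [hYfix, hZfix] at h
  by_contra hne
  have hpos : 0 < ‖Y - Z‖ := norm_pos_iff.2 (sub_ne_zero.2 hne)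
  exact (h.trans_lt (mul_lt_of_lt_one_left hpos hb)).false

theorem isUnit_one_add_of_norm_sub_le [CompleteSpace R] (hΓ : ‖Γ‖ ≤ γ) (hj : 1 ≤ j)
    (hb : (3 + 2 * √2) * j * γ * ‖b‖ < 1) {Y : R} (hY : ‖Y - b‖ ≤ √2 * ‖b‖) :
    IsUnit (1 + Γ Y) := by
  have hγ : 0 ≤ γ := (norm_nonneg Γ).trans hΓ
  have hlt : ‖-Γ Y‖ < 1 := by
    rw [norm_neg]
    calc ‖Γ Y‖ ≤ γ * ((1 + √2) * ‖b‖) :=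
        Γ.le_of_opNorm_le_of_le hΓ (norm_le_of_norm_sub_le_sqrt_two_mul hY)
      _ ≤ j * (γ * ((3 + 2 * √2) * ‖b‖)) := by
        refine le_trans ?_ (le_mul_of_one_le_left (by positivity) hj)
        gcongr ?_ * (?_ * _)
        linarith [Real.sqrt_nonneg 2]
      _ = (3 + 2 * √2) * j * γ * ‖b‖ := by ring
      _ < 1 := hb
  simpa using isUnit_one_sub_of_norm_lt_one hlt

theorem sub_mul_one_add_eq_of_similarityMap_eq {a Y : R} (hcomm : a * Γ Y - Γ Y * a = Y - J Y)
    (hfix : similarityMap b J Γ Y = Y) :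
    (a - b) * (1 + Γ Y) = (1 + Γ Y) * (a - J Y) := by
  rw [← sub_eq_zero]
  calc (a - b) * (1 + Γ Y) - (1 + Γ Y) * (a - J Y)
      = (a * Γ Y - Γ Y * a) + J Y - similarityMap b J Γ Y := by
        simp only [similarityMap]
        noncomm_ring
    _ = 0 := by
      rw [hcomm, hfix]
      abel

end SimilarityMap


/-- Theorem 3.1 of the paper in the case of a bounded unperturbed operator `A` and
`M = L(X)`: given transforms `J, Γ` on `L(X)` with `AΓ(Y) − Γ(Y)A = Y − J(Y)`,
`‖Γ‖ ≤ γ`, `j = max{1, ‖J‖}`, and `(3+2√2)jγ‖B‖ < 1`, the map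
`Φ(Y) = BΓ(Y) − Γ(Y)J(Y) + B` has a unique fixed point `X*` in the ball
`‖Y − B‖ ≤ √2‖B‖`, the operator `I + Γ(X*)` is invertible, and
`(A − B)(I + Γ(X*)) = (I + Γ(X*))(A − J(X*))`. -/
theorem stmt15 {X : Type*} [NormedAddCommGroup X] [NormedSpace ℂ X] [CompleteSpace X]
    (A B : X →L[ℂ] X)
    (J Γ : (X →L[ℂ] X) →L[ℂ] (X →L[ℂ] X))
    (hcomm : ∀ Y : X →L[ℂ] X, A * Γ Y - Γ Y * A = Y - J Y)
    (γ : ℝ) (hγ : ‖Γ‖ ≤ γ)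
    (hB : (3 + 2 * Real.sqrt 2) * max 1 ‖J‖ * γ * ‖B‖ < 1) :
    ∃ Xs : X →L[ℂ] X,
      (‖Xs - B‖ ≤ Real.sqrt 2 * ‖B‖ ∧ B * Γ Xs - Γ Xs * J Xs + B = Xs) ∧
      (∀ Y : X →L[ℂ] X, ‖Y - B‖ ≤ Real.sqrt 2 * ‖B‖ →
        B * Γ Y - Γ Y * J Y + B = Y → Y = Xs) ∧
      (∃ W : X →L[ℂ] X, (1 + Γ Xs) * W = 1 ∧ W * (1 + Γ Xs) = 1) ∧
      (A - B) * (1 + Γ Xs) = (1 + Γ Xs) * (A - J Xs) := by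
  have hJ : ‖J‖ ≤ max 1 ‖J‖ := le_max_right _ _
  have hj : 1 ≤ max 1 ‖J‖ := le_max_left _ _
  obtain ⟨Xs, hXs, hfix⟩ := exists_similarityMap_eq hγ hJ hj hB
  have hunit := isUnit_one_add_of_norm_sub_le hγ hj hB hXs
  exact ⟨Xs, ⟨hXs, hfix⟩,
    fun Y hY hYfix => eq_of_similarityMap_eq hγ hJ hj hB hY hXs hYfix hfix,
    isUnit_iff_exists.1 hunit,
    sub_mul_one_add_eq_of_similarityMap_eq (hcomm Xs) hfix⟩
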